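/- For every profile u of continuous money-monotone preferences satisfying the compensation assumption, a maxmin-utility envy-free allocation exists, and in the budget-constrained quasi-linear domain B the price vector of a maxmin-utility envy-free allocation for a given total rent is unique: if (r, μ) and (t, γ) are both maxmin-utility envy-free for rent m, then r = t, and every agent is indifferent between her two bundles. -/

import Mathlib

/-- Envy-freeness for a general utility profile. -/
def EnvyFree (n : ℕ) (u : Fin n → ℝ → Fin n → ℝ) (r : Fin n → ℝ)
    (σ : Equiv.Perm (Fin n)) : Prop :=
  ∀ i j : Fin n, u i (r (σ j)) (σ j) ≤ u i (r (σ i)) (σ i)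

/-- Maxmin-utility envy-free allocation for total rent `m`. -/
def MaxminEF (n : ℕ) (u : Fin n → ℝ → Fin n → ℝ) (m : ℝ) (r : Fin n → ℝ)
    (σ : Equiv.Perm (Fin n)) : Prop :=
  (∑ a, r a = m) ∧ EnvyFree n u r σ ∧
    ∀ (t : Fin n → ℝ) (γ : Equiv.Perm (Fin n)), (∑ a, t a = m) →
      EnvyFree n u t γ →
      (⨅ i, u i (t (γ i)) (γ i)) ≤ ⨅ i, u i (r (σ i)) (σ i)


/-- `f` is an envy-free assignment at prices `p`. -/
def EFa {n : ℕ} (u : Fin n → ℝ → Fin n → ℝ) (p : Fin n → ℝ) (f : Fin n → Fin n) : Prop :=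
  Function.Injective f ∧ ∀ i a, u i (p a) a ≤ u i (p (f i)) (f i)

/-- `p` supports an envy-free assignment. -/
def EFp {n : ℕ} (u : Fin n → ℝ → Fin n → ℝ) (p : Fin n → ℝ) : Prop :=
  ∃ f, EFa u p f

lemma count_lem {n : ℕ} (f g : Fin n → Fin n) (hf : Function.Injective f)
    (hg : Function.Injective g) (D : Fin n → Prop) (h : ∀ i, D (f i) → D (g i)) :
    ∀ i, D (g i) → D (f i) := by
  classical
  have key : ∀ k : Fin n → Fin n, Function.Injective k →
      (Finset.univ.filter fun i => D (k i)).card = (Finset.univ.filter fun a => D a).card := by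
    intro k hk
    apply Finset.card_bij (fun i _ => k i)
    · intro i hi; simpa using hi
    · intro i _ j _ hij; exact hk hij
    · intro b hb
      obtain ⟨i, rfl⟩ := (Finite.injective_iff_surjective.mp hk) b
      exact ⟨i, by simpa using hb, rfl⟩
  have hsub : (Finset.univ.filter fun i => D (f i)) ⊆ (Finset.univ.filter fun i => D (g i)) := by
    intro i hi
    simp only [Finset.mem_filter, Finset.mem_univ, true_and] at hi ⊢
    exact h i hi
  have he := Finset.eq_of_subset_of_card_le hsub (by rw [key f hf, key g hg])
  intro i hi
  have : i ∈ (Finset.univ.filter fun i => D (g i)) := by simpa using hi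
  rw [← he] at this
  simpa using this

lemma glue_inj {n : ℕ} (f g : Fin n → Fin n) (hf : Function.Injective f)
    (hg : Function.Injective g) (D A : Fin n → Prop) [DecidablePred A]
    (h1 : ∀ i, A i → D (f i)) (h2 : ∀ i, ¬ A i → ¬ D (g i)) :
    Function.Injective (fun i => if A i then f i else g i) := by
  intro i j hij
  by_cases hi : A i <;> by_cases hj : A j <;> simp only [hi, hj, if_true, if_false] at hij
  · exact hf hij
  · exact absurd (hij ▸ h1 i hi) (h2 j hj)
  · exact absurd (hij ▸ h1 j hj) (h2 i hi)
  · exact hg hij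

section
variable {n : ℕ} {u : Fin n → ℝ → Fin n → ℝ}

lemma dec_lem (ha : ∀ i a, StrictAnti fun p => u i p a) {p q : Fin n → ℝ} {f g : Fin n → Fin n}
    (hp : EFa u p f) (hq : EFa u q g) :
    ∀ i, q (f i) < p (f i) ↔ q (g i) < p (g i) := by
  have h : ∀ i, q (f i) < p (f i) → q (g i) < p (g i) := by
    intro i hi
    by_contra hcon
    push Not at hcon
    have h1 := ha i (f i) hi
    have h2 := (ha i (g i)).antitone hcon
    have h3 := hp.2 i (g i)
    have h4 := hq.2 i (f i)
    simp only at h1 h2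
    linarith
  exact fun i => ⟨h i, count_lem f g hp.1 hq.1 (fun a => q a < p a) h i⟩

lemma min_lem (ha : ∀ i a, StrictAnti fun p => u i p a) {p q : Fin n → ℝ}
    (hp : EFp u p) (hq : EFp u q) : EFp u (fun a => min (p a) (q a)) := by
  classical
  obtain ⟨f, hf⟩ := hp
  obtain ⟨g, hg⟩ := hq
  have hd := dec_lem ha hf hg
  refine ⟨fun i => if q (f i) < p (f i) then g i else f i, ?_, ?_⟩
  · exact glue_inj g f hg.1 hf.1 (fun a => q a < p a) (fun i => q (f i) < p (f i))
      (fun i hi => (hd i).1 hi) (fun i hi => hi)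
  · intro i a
    have hfa := hf.2 i a
    have hga := hg.2 i a
    by_cases hi : q (f i) < p (f i)
    · simp only [hi, if_true]
      rw [min_eq_right ((hd i).1 hi).le]
      rcases le_total (p a) (q a) with h | h
      · rw [min_eq_left h]
        have h1 := ha i (f i) hi
        have h4 := hg.2 i (f i)
        simp only at h1
        linarith
      · rw [min_eq_right h]; exact hga
    · simp only [hi, if_false]
      have hi' : ¬ q (g i) < p (g i) := fun h => hi ((hd i).2 h)
      push Not at hi hi'
      rw [min_eq_left hi]
      rcases le_total (p a) (q a) with h | h
      · rw [min_eq_left h]; exact hfa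
      · rw [min_eq_right h]
        have h1 := (ha i (g i)).antitone hi'
        have h4 := hf.2 i (g i)

        linarith

lemma max_lem (ha : ∀ i a, StrictAnti fun p => u i p a) {p q : Fin n → ℝ}
    (hp : EFp u p) (hq : EFp u q) : EFp u (fun a => max (p a) (q a)) ∧
      ∀ w, (∀ i, ∃ a, w ≤ u i (p a) a) → (∀ i, ∃ a, w ≤ u i (q a) a) →
        ∀ i, ∃ a, w ≤ u i (max (p a) (q a)) a := by
  classical
  obtain ⟨f, hf⟩ := hp
  obtain ⟨g, hg⟩ := hq
  have hd := dec_lem ha hf hg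
  refine ⟨⟨fun i => if q (f i) < p (f i) then f i else g i, ?_, ?_⟩, ?_⟩
  · exact glue_inj f g hf.1 hg.1 (fun a => q a < p a) (fun i => q (f i) < p (f i))
      (fun i hi => hi) (fun i hi h => hi ((hd i).2 h))
  · intro i a
    have hfa := hf.2 i a
    have hga := hg.2 i a
    by_cases hi : q (f i) < p (f i)
    · simp only [hi, if_true]
      rw [max_eq_left hi.le]
      exact ((ha i a).antitone (le_max_left (p a) (q a))).trans hfa
    · simp only [hi, if_false]
      have hi' : ¬ q (g i) < p (g i) := fun h => hi ((hd i).2 h)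
      push Not at hi'
      rw [max_eq_right hi']
      exact ((ha i a).antitone (le_max_right (p a) (q a))).trans hga
  · intro w h1 h2 i
    by_cases hi : q (f i) < p (f i)
    · refine ⟨f i, ?_⟩
      rw [max_eq_left hi.le]
      obtain ⟨a, h⟩ := h1 i
      exact h.trans (hf.2 i a)
    · have hi' : ¬ q (g i) < p (g i) := fun h => hi ((hd i).2 h)
      push Not at hi'
      refine ⟨g i, ?_⟩
      rw [max_eq_right hi']
      obtain ⟨a, h⟩ := h2 i
      exact h.trans (hg.2 i a)

/-- Auction states. -/
def AState (u : Fin n → ℝ → Fin n → ℝ) (R : Fin n → ℝ) (a0 : Fin n) (ε : ℝ)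
    (k : Fin n → ℕ) (μ : Fin n → Fin n) : Prop :=
  k a0 = 0 ∧
  (∀ i, μ i ≠ a0 → ∀ a, u i (R a + ε * k a + ε) a ≤ u i (R (μ i) + ε * k (μ i)) (μ i)) ∧
  (∀ i j, μ i = μ j → μ i ≠ a0 → i = j) ∧
  (∀ a, 0 < k a → ∃ i, μ i = a)

lemma astate_step (ha : ∀ i a, StrictAnti fun p => u i p a) {R : Fin n → ℝ} {a0 : Fin n} {ε : ℝ}
    (hε : 0 < ε) {k : Fin n → ℕ} {μ : Fin n → Fin n} (h : AState u R a0 ε k μ)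
    (i : Fin n) (hi : μ i = a0) (b : Fin n)
    (hb : u i (R a0) a0 < u i (R b + ε * k b + ε) b) :
    ∃ k' μ', AState u R a0 ε k' μ' ∧ ∑ a, k a < ∑ a, k' a := by
  classical
  obtain ⟨h0, h1, h2, h3⟩ := h
  obtain ⟨c, -, hc⟩ := Finset.exists_max_image Finset.univ
    (fun a => u i (R a + ε * k a + ε) a) ⟨a0, Finset.mem_univ _⟩
  have hcb := hc b (Finset.mem_univ _)

  have hca : c ≠ a0 := by
    rintro rfl
    rw [h0] at hcb
    have := ha i c (show R c < R c + ε * ((0:ℕ):ℝ) + ε by simp [hε])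
    simp only at this
    linarith
  have hk : ∀ a, R a + ε * k a ≤ R a + ε * (Function.update k c (k c + 1) a : ℕ) := by
    intro a
    by_cases hac : a = c
    · subst hac; simp; nlinarith
    · simp [hac]
  refine ⟨Function.update k c (k c + 1),
    fun j => if j = i then c else if μ j = c then a0 else μ j, ⟨?_, ?_, ?_, ?_⟩, ?_⟩
  · simp [hca.symm, h0]
  · intro j hj a
    by_cases hji : j = i
    · subst hji
      simp only [if_true, Function.update_self]
      have e : R c + ε * ((k c + 1 : ℕ) : ℝ) = R c + ε * k c + ε := by push_cast; ring
      rw [e]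
      refine le_trans ?_ (hc a (Finset.mem_univ _))
      exact (ha j a).antitone (by linarith [hk a])
    · simp only [hji, if_false] at hj ⊢
      by_cases hjc : μ j = c
      · simp [hjc] at hj
      · simp only [hjc, if_false] at hj ⊢
        rw [Function.update_of_ne hjc]
        refine le_trans ?_ (h1 j hj a)
        exact (ha j a).antitone (by linarith [hk a])
  · intro j l hjl hj
    by_cases hji : j = i <;> by_cases hli : l = i
    · rw [hji, hli]
    · simp only [hji, hli, if_true, if_false] at hjl
      by_cases hlc : μ l = c
      · simp [hlc] at hjl; exact absurd hjl hca
      · simp [hlc] at hjl; exact absurd hjl.symm hlc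
    · simp only [hji, hli, if_true, if_false] at hjl
      by_cases hlc : μ j = c
      · simp [hlc] at hjl; exact absurd hjl.symm hca
      · simp [hlc] at hjl
    · simp only [hji, hli, if_false] at hjl hj
      by_cases hjc : μ j = c
      · simp [hjc] at hj
      · simp only [hjc, if_false] at hjl hj
        by_cases hlc : μ l = c
        · simp [hlc] at hjl; exact absurd hjl hj
        · simp only [hlc, if_false] at hjl
          exact h2 j l hjl hj
  · intro a hak
    by_cases hac : a = c
    · exact ⟨i, by simp [hac]⟩
    · rw [Function.update_of_ne hac] at hak
      obtain ⟨j, hj⟩ := h3 a hak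
      have haa : a ≠ a0 := by rintro rfl; omega
      have hji : j ≠ i := by rintro rfl; exact haa (hj.symm.trans hi)
      exact ⟨j, by simp [hji, hj, hac]⟩
  · apply Finset.sum_lt_sum
    · intro a _
      by_cases hac : a = c
      · subst hac; simp
      · simp [hac]
    · exact ⟨c, Finset.mem_univ _, by simp⟩

lemma exists_bound (ha : ∀ i a, StrictAnti fun p => u i p a)
    (hcomp : ∀ i : Fin n, ∀ a c : Fin n, ∀ p : ℝ, ∃ q : ℝ, u i p a = u i q c) (y : ℝ) :
    ∃ B : ℝ, ∀ i a c, ∀ p, u i y a ≤ u i p c → p ≤ B := by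
  choose q hq using hcomp
  obtain ⟨B, hB⟩ := (Set.finite_range
    (fun x : Fin n × Fin n × Fin n => q x.1 x.2.1 x.2.2 y)).bddAbove
  refine ⟨B, fun i a c p h => ?_⟩
  rw [hq i a c y] at h
  exact ((ha i c).le_iff_ge.mp h).trans (hB ⟨(i, a, c), rfl⟩)

lemma exists_low (ha : ∀ i a, StrictAnti fun p => u i p a)
    (hcomp : ∀ i : Fin n, ∀ a c : Fin n, ∀ p : ℝ, ∃ q : ℝ, u i p a = u i q c) (y : ℝ) :
    ∃ B : ℝ, ∀ i a c, ∀ p, p ≤ B → u i y a ≤ u i p c := by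
  choose q hq using hcomp
  obtain ⟨B, hB⟩ := (Set.finite_range
    (fun x : Fin n × Fin n × Fin n => q x.1 x.2.1 x.2.2 y)).bddBelow
  refine ⟨B, fun i a c p h => ?_⟩
  rw [hq i a c y]
  exact (ha i c).antitone (h.trans (hB ⟨(i, a, c), rfl⟩))

lemma auction_eps (ha : ∀ i a, StrictAnti fun p => u i p a)
    (hcomp : ∀ i : Fin n, ∀ a c : Fin n, ∀ p : ℝ, ∃ q : ℝ, u i p a = u i q c)
    (R : Fin n → ℝ) (a0 : Fin n) (ε : ℝ) (hε : 0 < ε) :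
    ∃ (t : Fin n → ℝ) (μ : Fin n → Fin n), (∀ a, R a ≤ t a) ∧ t a0 = R a0 ∧
      (∀ i a, u i (t a + ε) a ≤ u i (t (μ i)) (μ i)) ∧
      (∀ i j, μ i = μ j → μ i ≠ a0 → i = j) ∧
      (∀ a, (∀ i, μ i ≠ a) → t a = R a) := by
  classical
  obtain ⟨B, hB⟩ := exists_bound ha hcomp (R a0 + ε)
  -- bound on the total
  have hbd : ∃ N : ℕ, ∀ k μ, AState u R a0 ε k μ → ∑ a, k a ≤ N := by
    have : ∀ a, ∃ N : ℕ, ∀ k μ, AState u R a0 ε k μ → k a ≤ N := by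
      intro a
      obtain ⟨N, hN⟩ := exists_nat_ge ((B - R a) / ε)
      refine ⟨N, fun k μ h => ?_⟩
      rcases Nat.eq_zero_or_pos (k a) with h0 | h0
      · omega
      obtain ⟨i, hi⟩ := h.2.2.2 a h0
      have haa : a ≠ a0 := by rintro rfl; have := h.1; omega
      have h1 := h.2.1 i (by rw [hi]; exact haa) a0
      rw [hi, h.1] at h1
      have h2 := hB i a0 a (R a + ε * k a) (by simpa using h1)
      have h3 : (k a : ℝ) ≤ (B - R a) / ε := by
        rw [le_div_iff₀ hε]; linarith
      exact_mod_cast h3.trans hN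
    choose N hN using this
    exact ⟨∑ a, N a, fun k μ h => Finset.sum_le_sum fun a _ => hN a k μ h⟩
  obtain ⟨N, hN⟩ := hbd
  let S : Set ℕ := {s | ∃ k μ, AState u R a0 ε k μ ∧ ∑ a, k a = s}
  have hS0 : S.Nonempty := ⟨0, fun _ => 0, fun _ => a0, ⟨rfl, by simp, by simp, by simp⟩, by simp⟩
  have hSb : BddAbove S := ⟨N, by rintro s ⟨k, μ, h, rfl⟩; exact hN k μ h⟩
  obtain ⟨k, μ, h, hs⟩ := Nat.sSup_mem hS0 hSb
  have hmax : ∀ k' μ', AState u R a0 ε k' μ' → ∑ a, k' a ≤ ∑ a, k a := by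
    intro k' μ' h'
    rw [hs]; exact le_csSup hSb ⟨k', μ', h', rfl⟩
  refine ⟨fun a => R a + ε * k a, μ, ?_, ?_, ?_, h.2.2.1, ?_⟩
  · intro a; simp only; have : 0 ≤ ε * k a := by positivity
    linarith
  · simp [h.1]
  · intro i a
    by_cases hi : μ i = a0
    · by_contra hcon
      push Not at hcon
      simp only [hi, h.1] at hcon
      obtain ⟨k', μ', h', hlt⟩ := astate_step ha hε h i hi a (by simpa using hcon)
      exact absurd (hmax k' μ' h') (by omega)
    · exact h.2.1 i hi a
  · intro a hna
    have : k a = 0 := by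
      by_contra hk
      obtain ⟨i, hi⟩ := h.2.2.2 a (Nat.pos_of_ne_zero hk)
      exact hna i hi
    simp [this]

open Filter Topology in
lemma auction (hc : ∀ i a, Continuous fun p => u i p a)
    (ha : ∀ i a, StrictAnti fun p => u i p a)
    (hcomp : ∀ i : Fin n, ∀ a c : Fin n, ∀ p : ℝ, ∃ q : ℝ, u i p a = u i q c)
    (R : Fin n → ℝ) (a0 : Fin n) :
    ∃ (t : Fin n → ℝ) (μ : Fin n → Fin n), (∀ a, R a ≤ t a) ∧ t a0 = R a0 ∧
      (∀ i a, u i (t a) a ≤ u i (t (μ i)) (μ i)) ∧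
      (∀ i j, μ i = μ j → μ i ≠ a0 → i = j) ∧
      (∀ a, (∀ i, μ i ≠ a) → t a = R a) := by
  classical
  have hpos : ∀ k : ℕ, (0:ℝ) < 1 / ((k:ℝ) + 1) := fun k => by positivity
  choose t μ h1 h2 h3 h4 h5 using fun k : ℕ => auction_eps ha hcomp R a0 (1 / ((k:ℝ)+1)) (hpos k)
  obtain ⟨B, hB⟩ := exists_bound ha hcomp (R a0 + 1)
  have hle : ∀ k a, t k a ≤ max B (R a) := by
    intro k a
    by_cases hk : ∀ i, μ k i ≠ a
    · rw [h5 k a hk]; exact le_max_right _ _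
    · push Not at hk
      obtain ⟨i, hi⟩ := hk
      have := h3 k i a0
      rw [hi, h2 k] at this
      refine le_trans (hB i a0 a _ (le_trans ?_ this)) (le_max_left _ _)
      apply (ha i a0).antitone
      have : 1 / ((k:ℝ)+1) ≤ 1 := by
        rw [div_le_one (by positivity)]; have : (0:ℝ) ≤ k := by positivity
        linarith
      linarith
  have hK : IsCompact (Set.Icc R (fun a => max B (R a)) ×ˢ (Set.univ : Set (Fin n → Fin n))) :=
    isCompact_Icc.prod isCompact_univ
  obtain ⟨⟨T, M⟩, -, φ, hφ, hlim⟩ := hK.tendsto_subseq (x := fun k => (t k, μ k))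
    (fun k => ⟨⟨h1 k, hle k⟩, trivial⟩)
  have hT : Tendsto (fun k => t (φ k)) atTop (𝓝 T) := (continuous_fst.tendsto _).comp hlim
  have hM : Tendsto (fun k => μ (φ k)) atTop (𝓝 M) := (continuous_snd.tendsto _).comp hlim
  have hTa : ∀ a, Tendsto (fun k => t (φ k) a) atTop (𝓝 (T a)) := fun a =>
    (continuous_apply a).continuousAt.tendsto.comp hT
  have hMe : ∀ᶠ k in atTop, μ (φ k) = M := by
    rw [nhds_discrete] at hM
    exact tendsto_pure.mp hM
  have hε : Tendsto (fun k => 1 / ((φ k : ℝ) + 1)) atTop (𝓝 0) :=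
    (tendsto_one_div_add_atTop_nhds_zero_nat (𝕜 := ℝ)).comp hφ.tendsto_atTop
  obtain ⟨k0, hk0⟩ := hMe.exists
  refine ⟨T, M, ?_, ?_, ?_, ?_, ?_⟩
  · intro a; exact ge_of_tendsto' (hTa a) fun k => h1 _ a
  · refine tendsto_nhds_unique (hTa a0) ?_
    simp only [h2]; exact tendsto_const_nhds
  · intro i a
    have e1 : Tendsto (fun k => u i (t (φ k) a + 1 / ((φ k : ℝ) + 1)) a) atTop
        (𝓝 (u i (T a) a)) := by
      have := ((hTa a).add hε)
      rw [add_zero] at this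
      exact ((hc i a).tendsto _).comp this
    have e2 : Tendsto (fun k => u i (t (φ k) (M i)) (M i)) atTop (𝓝 (u i (T (M i)) (M i))) :=
      ((hc i (M i)).tendsto _).comp (hTa (M i))
    refine le_of_tendsto_of_tendsto e1 e2 ?_
    filter_upwards [hMe] with k hk
    have := h3 (φ k) i a
    rw [hk] at this
    exact this
  · rw [← hk0]; exact h4 (φ k0)
  · intro a hna
    refine tendsto_nhds_unique (hTa a) ?_
    refine Tendsto.congr' ?_ (tendsto_const_nhds (x := R a))
    filter_upwards [hMe] with k hk
    exact (h5 (φ k) a (by rw [hk]; exact hna)).symm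

lemma inj_of_sold {μ : Fin n → Fin n} {a0 : Fin n}
    (h4 : ∀ i j, μ i = μ j → μ i ≠ a0 → i = j) (h : ∀ a, a ≠ a0 → ∃ i, μ i = a) :
    Function.Injective μ := by
  rw [Finite.injective_iff_surjective]
  by_contra hcon
  have hno : ∀ i, μ i ≠ a0 := by
    intro i hi
    apply hcon
    intro a
    by_cases haa : a = a0
    · exact ⟨i, hi.trans haa.symm⟩
    · exact h a haa
  exact hcon (Finite.injective_iff_surjective.mp fun i j hij => h4 i j hij (hno i))

lemma step_lem (hc : ∀ i a, Continuous fun p => u i p a)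
    (ha : ∀ i a, StrictAnti fun p => u i p a)
    (hcomp : ∀ i : Fin n, ∀ a c : Fin n, ∀ p : ℝ, ∃ q : ℝ, u i p a = u i q c)
    {p : Fin n → ℝ} (hp : EFp u p) (a0 : Fin n) (x : ℝ) (hx : p a0 < x) :
    ∃ t, EFp u t ∧ p ≤ t ∧ t a0 = x := by
  classical
  obtain ⟨t, μ, h1, h2, h3, h4, h5⟩ := auction hc ha hcomp (Function.update p a0 x) a0
  rw [Function.update_self] at h2
  have hpt : p ≤ t := by
    intro a
    by_cases haa : a = a0
    · subst haa; rw [h2]; exact hx.le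
    · have := h1 a; rwa [Function.update_of_ne haa] at this
  obtain ⟨f, hf⟩ := hp
  refine ⟨t, ⟨μ, inj_of_sold h4 ?_, h3⟩, hpt, h2⟩
  intro a haa
  by_contra hna
  push Not at hna
  have hta := h5 a hna
  rw [Function.update_of_ne haa] at hta
  -- E = {t = p}
  have hE : ∀ i, t (f i) = p (f i) → t (μ i) = p (μ i) := by
    intro i hi
    by_contra hne
    have hlt : p (μ i) < t (μ i) := lt_of_le_of_ne (hpt _) (Ne.symm hne)
    have e1 := ha i (μ i) hlt
    have e2 := hf.2 i (μ i)
    have e3 := h3 i (f i)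
    rw [hi] at e3
    simp only at e1
    linarith
  have hEa0 : ¬ t a0 = p a0 := by rw [h2]; exact hx.ne'
  let A := Finset.univ.filter fun i => t (f i) = p (f i)
  let E := Finset.univ.filter fun a => t a = p a
  have hcard : A.card = E.card := by
    apply Finset.card_bij (fun i _ => f i)
    · intro i hi; simpa [A, E] using hi
    · intro i _ j _ hij; exact hf.1 hij
    · intro b hb
      obtain ⟨i, rfl⟩ := (Finite.injective_iff_surjective.mp hf.1) b
      exact ⟨i, by simpa [A, E] using hb, rfl⟩
  have hsub : A.image μ ⊆ E.erase a := by
    intro b hb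
    obtain ⟨i, hi, rfl⟩ := Finset.mem_image.mp hb
    simp only [A, E, Finset.mem_filter, Finset.mem_univ, true_and, Finset.mem_erase] at hi ⊢
    exact ⟨hna i, hE i hi⟩
  have hinj : Set.InjOn μ A := by
    intro i hi j _ hij
    refine h4 i j hij ?_
    intro h0
    have := hE i (by simpa [A] using hi)
    rw [h0] at this
    exact hEa0 this
  have haE : a ∈ E := by simp [E, hta]
  have := Finset.card_le_card hsub
  rw [Finset.card_image_of_injOn hinj, Finset.card_erase_of_mem haE] at this
  have : 0 < E.card := Finset.card_pos.mpr ⟨a, haE⟩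
  omega

lemma low_lem (hn : 0 < n) (hc : ∀ i a, Continuous fun p => u i p a)
    (ha : ∀ i a, StrictAnti fun p => u i p a)
    (hcomp : ∀ i : Fin n, ∀ a c : Fin n, ∀ p : ℝ, ∃ q : ℝ, u i p a = u i q c) (y : ℝ) :
    ∃ t, EFp u t ∧ ∀ a, t a ≤ y := by
  classical
  let a0 : Fin n := ⟨0, hn⟩
  obtain ⟨x, hx⟩ := exists_low ha hcomp y
  obtain ⟨z, hz⟩ := exists_low ha hcomp x
  obtain ⟨t, μ, h1, h2, h3, h4, h5⟩ :=
    auction hc ha hcomp (Function.update (fun _ => z - 1) a0 x) a0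
  rw [Function.update_self] at h2
  have hinj : Function.Injective μ := by
    apply inj_of_sold h4
    intro a haa
    by_contra hna
    push Not at hna
    have hta := h5 a hna
    rw [Function.update_of_ne haa] at hta
    have hno : ∀ i, μ i ≠ a0 := by
      intro i hi
      have e1 := h3 i a
      rw [hi, h2, hta] at e1
      have e2 := hz i a0 a z le_rfl
      have e3 := ha i a (show z - 1 < z by linarith)
      simp only at e3
      linarith
    have hi : Function.Injective μ := fun i j hij => h4 i j hij (hno i)
    obtain ⟨i, hi⟩ := Finite.injective_iff_surjective.mp hi a
    exact hna i hi
  refine ⟨t, ⟨μ, hinj, h3⟩, fun a => ?_⟩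
  obtain ⟨i, rfl⟩ := Finite.injective_iff_surjective.mp hinj a
  have e1 := h3 i a0
  rw [h2] at e1
  exact (ha i (μ i)).le_iff_ge.mp ((hx i (μ i) a0 x le_rfl).trans e1)

lemma closed_EF (hc : ∀ i a, Continuous fun p => u i p a) : IsClosed {p | EFp u p} := by
  have : {p | EFp u p} = ⋃ f : Fin n → Fin n, {p | EFa u p f} := by
    ext p; simp [EFp]
  rw [this]
  apply isClosed_iUnion_of_finite
  intro f
  by_cases hf : Function.Injective f
  · have : {p | EFa u p f} = ⋂ i, ⋂ a, {p : Fin n → ℝ | u i (p a) a ≤ u i (p (f i)) (f i)} := by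
      ext p; simp [EFa, hf]
    rw [this]
    refine isClosed_iInter fun i => isClosed_iInter fun a => ?_
    exact isClosed_le ((hc i a).comp (continuous_apply a))
      ((hc i (f i)).comp (continuous_apply (f i)))
  · have : {p | EFa u p f} = ∅ := by
      ext p; simp [EFa, hf]
    rw [this]; exact isClosed_empty

lemma cont_sum : Continuous fun p : Fin n → ℝ => ∑ a, p a :=
  continuous_finsetSum _ fun a _ => continuous_apply a

lemma interp (hc : ∀ i a, Continuous fun p => u i p a)
    (ha : ∀ i a, StrictAnti fun p => u i p a)
    (hcomp : ∀ i : Fin n, ∀ a c : Fin n, ∀ p : ℝ, ∃ q : ℝ, u i p a = u i q c)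
    {p q : Fin n → ℝ} (hp : EFp u p) (hq : EFp u q) (hpq : p ≤ q) (m : ℝ)
    (h1 : ∑ a, p a ≤ m) (h2 : m ≤ ∑ a, q a) :
    ∃ t, EFp u t ∧ p ≤ t ∧ t ≤ q ∧ ∑ a, t a = m := by
  have K1 : IsCompact ((Set.Icc p q ∩ {p | EFp u p}) ∩ {p | ∑ a, p a ≤ m}) :=
    (isCompact_Icc.inter_right (closed_EF hc)).inter_right
      (isClosed_le cont_sum continuous_const)
  obtain ⟨p', ⟨⟨hp'1, hp'2⟩, hp'3⟩, hpmax⟩ := K1.exists_isMaxOn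
    ⟨p, ⟨⟨le_rfl, hpq⟩, hp⟩, h1⟩ cont_sum.continuousOn
  have K2 : IsCompact ((Set.Icc p' q ∩ {p | EFp u p}) ∩ {p | m ≤ ∑ a, p a}) :=
    (isCompact_Icc.inter_right (closed_EF hc)).inter_right
      (isClosed_le continuous_const cont_sum)
  obtain ⟨q', ⟨⟨hq'1, hq'2⟩, hq'3⟩, hqmin⟩ := K2.exists_isMinOn
    ⟨q, ⟨⟨hp'1.2, le_rfl⟩, hq⟩, h2⟩ cont_sum.continuousOn
  simp only [Set.mem_ofPred_eq] at hp'2 hp'3 hq'2 hq'3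
  rcases eq_or_lt_of_le hp'3 with e | hlt
  · exact ⟨p', hp'2, hp'1.1, hp'1.2, e⟩
  rcases eq_or_lt_of_le hq'3 with e | hlt2
  · exact ⟨q', hq'2, hp'1.1.trans hq'1.1, hq'1.2, e.symm⟩
  exfalso
  obtain ⟨a0, -, ha0⟩ := Finset.exists_lt_of_sum_lt (hlt.trans hlt2)
  obtain ⟨x, hx1, hx2⟩ := exists_between ha0
  obtain ⟨t, ht, hpt, htx⟩ := step_lem hc ha hcomp hp'2 a0 x hx1
  have hT := min_lem ha ht hq'2
  set T := fun a => min (t a) (q' a) with hTdef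
  have hT1 : p' ≤ T := fun a => le_min (hpt a) (hq'1.1 a)
  have hT2 : T ≤ q' := fun a => min_le_right _ _
  have hTx : T a0 = x := by simp [hTdef, htx, hx2.le]
  have s1 : ∑ a, p' a < ∑ a, T a :=
    Finset.sum_lt_sum (fun a _ => hT1 a) ⟨a0, Finset.mem_univ _, by rw [hTx]; exact hx1⟩
  have s2 : ∑ a, T a < ∑ a, q' a :=
    Finset.sum_lt_sum (fun a _ => hT2 a) ⟨a0, Finset.mem_univ _, by rw [hTx]; exact hx2⟩
  rcases le_total (∑ a, T a) m with h | h
  · have := hpmax ⟨⟨⟨hp'1.1.trans hT1, hT2.trans hq'1.2⟩, hT⟩, h⟩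
    simp only [Set.mem_ofPred_eq] at this
    linarith
  · have := hqmin ⟨⟨⟨hT1, hT2.trans hq'1.2⟩, hT⟩, h⟩
    simp only [Set.mem_ofPred_eq] at this
    linarith

lemma below_lem (hn : 0 < n) (hc : ∀ i a, Continuous fun p => u i p a)
    (ha : ∀ i a, StrictAnti fun p => u i p a)
    (hcomp : ∀ i : Fin n, ∀ a c : Fin n, ∀ p : ℝ, ∃ q : ℝ, u i p a = u i q c)
    {q : Fin n → ℝ} (hq : EFp u q) (m : ℝ) (h : m ≤ ∑ a, q a) :
    ∃ t, EFp u t ∧ t ≤ q ∧ ∑ a, t a = m := by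
  obtain ⟨B, hB⟩ := (Set.finite_range q).bddBelow
  obtain ⟨p, hp, hpy⟩ := low_lem hn hc ha hcomp (min B (m / n))
  have hn' : (0:ℝ) < n := by exact_mod_cast hn
  obtain ⟨t, ht, -, h2, h3⟩ := interp hc ha hcomp hp hq
    (fun a => (hpy a).trans ((min_le_left _ _).trans (hB ⟨a, rfl⟩))) m
    (by
      calc ∑ a, p a ≤ ∑ _a : Fin n, m / n :=
            Finset.sum_le_sum fun a _ => (hpy a).trans (min_le_right _ _)
        _ = m := by simp; field_simp) h
  exact ⟨t, ht, h2, h3⟩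

lemma exists_EF (hn : 0 < n) (hc : ∀ i a, Continuous fun p => u i p a)
    (ha : ∀ i a, StrictAnti fun p => u i p a)
    (hcomp : ∀ i : Fin n, ∀ a c : Fin n, ∀ p : ℝ, ∃ q : ℝ, u i p a = u i q c) (m : ℝ) :
    ∃ t, EFp u t ∧ ∑ a, t a = m := by
  obtain ⟨p, hp, -⟩ := low_lem hn hc ha hcomp 0
  let a0 : Fin n := ⟨0, hn⟩
  obtain ⟨q, hq, hpq, hqx⟩ := step_lem hc ha hcomp hp a0 (p a0 + |m - ∑ a, p a| + 1)
    (by have := abs_nonneg (m - ∑ a, p a); linarith)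
  have : m ≤ ∑ a, q a := by
    have h1 : q a0 - p a0 ≤ ∑ a, (q a - p a) :=
      Finset.single_le_sum (f := fun a => q a - p a)
        (fun a _ => sub_nonneg.mpr (hpq a)) (Finset.mem_univ a0)
    rw [Finset.sum_sub_distrib, hqx] at h1
    have := le_abs_self (m - ∑ a, p a)
    linarith
  obtain ⟨t, ht, -, h3⟩ := below_lem hn hc ha hcomp hq m this
  exact ⟨t, ht, h3⟩

end
section
variable {n : ℕ} {u : Fin n → ℝ → Fin n → ℝ}

/-- Gluing of two envy-free price vectors along an isolated block `D`. -/
lemma glue_lem (ha : ∀ i a, StrictAnti fun p => u i p a)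
    {P P' g : Fin n → ℝ} {F : Fin n → Fin n} (hF : Function.Injective F)
    (hP : EFp u P) (hP' : EFp u P') (D : Fin n → Prop)
    (hgD : ∀ a, D a → g a = P a) (hgZ : ∀ a, ¬ D a → g a = P' a) (hle : P' ≤ g)
    (h1 : ∀ i, D (F i) → ∀ z, ¬ D z → u i (P z) z < u i (P (F i)) (F i))
    (h2 : ∀ i, D (F i) → ∀ z, ¬ D z → u i (P' z) z < u i (P' (F i)) (F i))
    (h3 : ∀ i, D (F i) → ∀ z, ¬ D z → u i (g z) z < u i (g (F i)) (F i)) :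
    EFp u g := by
  classical
  obtain ⟨f, hf⟩ := hP
  obtain ⟨f', hf'⟩ := hP'
  have k1 : ∀ i, D (F i) → D (f i) := by
    intro i hi
    by_contra hcon
    have := h1 i hi _ hcon
    have := hf.2 i (F i)
    linarith
  have k2 : ∀ i, D (F i) → D (f' i) := by
    intro i hi
    by_contra hcon
    have := h2 i hi _ hcon
    have := hf'.2 i (F i)
    linarith
  have k3 : ∀ i, ¬ D (F i) → ¬ D (f' i) := fun i hi h =>
    hi (count_lem F f' hF hf'.1 D k2 i h)
  refine ⟨fun i => if D (F i) then f i else f' i, ?_, ?_⟩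
  · exact glue_inj f f' hf.1 hf'.1 D (fun i => D (F i)) k1 k3
  · intro i a
    by_cases hi : D (F i)
    · simp only [hi, if_true]
      rw [hgD _ (k1 i hi)]
      by_cases hD : D a
      · rw [hgD a hD]; exact hf.2 i a
      · refine (h3 i hi a hD).le.trans ?_
        rw [hgD _ hi]; exact hf.2 i _
    · simp only [hi, if_false]
      rw [hgZ _ (k3 i hi)]
      exact ((ha i a).antitone (hle a)).trans (hf'.2 i a)

open Filter Topology in
lemma perturb_one (hn : 0 < n) (hc : ∀ i a, Continuous fun p => u i p a)
    (ha : ∀ i a, StrictAnti fun p => u i p a)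
    (hcomp : ∀ i : Fin n, ∀ a c : Fin n, ∀ p : ℝ, ∃ q : ℝ, u i p a = u i q c)
    {q : Fin n → ℝ} (hq : EFp u q) (a0 : Fin n) (ε : ℝ) (hε : 0 < ε) :
    ∃ s, EFp u s ∧ s ≤ q ∧ s a0 < q a0 ∧ ∑ a, q a - ε < ∑ a, s a := by
  classical
  by_contra hcon
  push Not at hcon
  obtain ⟨B, hB⟩ := (Set.finite_range q).bddBelow
  obtain ⟨s0, hs0, hs0y⟩ := low_lem hn hc ha hcomp (B - 1)
  have hs0q : ∀ a, s0 a < q a := fun a => by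
    have := hs0y a; have := hB ⟨a, rfl⟩; linarith
  let Y : Set (Fin n → ℝ) := {s | EFp u s ∧ s ≤ q ∧ s a0 < q a0 ∧ ∑ a, s0 a ≤ ∑ a, s a}
  have hY0 : s0 ∈ Y := ⟨hs0, fun a => (hs0q a).le, hs0q a0, le_rfl⟩
  let C : Set (Fin n → ℝ) := (Set.Icc (fun a => ∑ b, s0 b - (∑ b, q b - q a)) q ∩ {p | EFp u p})
    ∩ {s | ∑ a, s a ≤ ∑ a, q a - ε}
  have hC : IsCompact C := (isCompact_Icc.inter_right (closed_EF hc)).inter_right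
      (isClosed_le cont_sum continuous_const)
  have hYC : Y ⊆ C := by
    rintro s ⟨e1, e2, e3, e4⟩
    refine ⟨⟨⟨fun a => ?_, e2⟩, e1⟩, hcon s e1 e2 e3⟩
    have : q a - s a ≤ ∑ b, (q b - s b) :=
      Finset.single_le_sum (f := fun b => q b - s b)
        (fun b _ => sub_nonneg.mpr (e2 b)) (Finset.mem_univ a)
    rw [Finset.sum_sub_distrib] at this
    simp only
    linarith
  have hclC : closure Y ⊆ C := closure_minimal hYC hC.isClosed
  have hcl : IsCompact (closure Y) := hC.of_isClosed_subset isClosed_closure hclC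
  obtain ⟨c, hcY, hcmax⟩ := hcl.exists_isMaxOn ⟨s0, subset_closure hY0⟩ cont_sum.continuousOn
  obtain ⟨⟨⟨-, hcq⟩, hcEF⟩, hcs⟩ := hclC hcY
  simp only [Set.mem_ofPred_eq] at hcEF hcs
  have hmax : ∀ s ∈ Y, ∑ a, s a ≤ ∑ a, c a := fun s hs => by
    have := hcmax (subset_closure hs)
    simpa using this
  have hs0c := hmax s0 hY0
  obtain ⟨F, hF⟩ := id hcEF
  obtain ⟨G, hG⟩ := id hq
  have hdec := dec_lem ha hG hF
  have hstrict : ∀ i, c (F i) < q (F i) → ∀ z, ¬ c z < q z →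
      u i (c z) z < u i (c (F i)) (F i) := by
    intro i hi z hz
    have hz' : c z = q z := le_antisymm (hcq z) (not_lt.mp hz)
    rw [hz']
    have e1 := hG.2 i z
    have e2 := ha i (G i) ((hdec i).2 hi)
    have e3 := hF.2 i (G i)
    simp only at e2
    linarith
  have hnear : ∀ᶠ p in 𝓝 c, (∀ i, c (F i) < q (F i) → ∀ z, ¬ c z < q z →
      u i (p z) z < u i (p (F i)) (F i)) ∧ (c a0 < q a0 → p a0 < q a0) := by
    refine Filter.Eventually.and ?_ ?_
    · rw [eventually_all]; intro i
      by_cases hi : c (F i) < q (F i)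
      · simp only [hi, true_imp_iff]
        rw [eventually_all]; intro z
        by_cases hz : c z < q z
        · simp [hz]
        · simp only [hz, not_false_iff, true_imp_iff]
          exact (((hc i z).comp (continuous_apply z)).continuousAt).eventually_lt
            (((hc i (F i)).comp (continuous_apply (F i))).continuousAt) (hstrict i hi z hz)
      · simp [hi]
    · by_cases h : c a0 < q a0
      · simp only [h, true_imp_iff]
        exact (continuous_apply a0).continuousAt.eventually_lt continuousAt_const h
      · simp [h]
  obtain ⟨η, hη, hball⟩ := Metric.eventually_nhds_iff.mp hnear
  have hball' : ∀ p : Fin n → ℝ, (∀ a, |p a - c a| < η) → _ := fun p hp =>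
    @hball p ((dist_pi_lt_iff hη).mpr fun a => by rw [Real.dist_eq]; exact hp a)
  -- interpolate slightly above `c`
  set δ := min (η / 2) ε with hδ
  have hδ0 : 0 < δ := lt_min (by linarith) hε
  have hδη : δ < η := lt_of_le_of_lt (min_le_left _ _) (by linarith)
  have hδε : δ ≤ ε := min_le_right _ _
  obtain ⟨s, hs, hcs1, hsq, hssum⟩ := interp hc ha hcomp hcEF hq hcq (∑ a, c a + δ)
    (by linarith) (by linarith)
  have hsa : ∀ a, s a ≤ c a + δ := by
    intro a
    have : s a - c a ≤ ∑ b, (s b - c b) :=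
      Finset.single_le_sum (f := fun b => s b - c b)
        (fun b _ => sub_nonneg.mpr (hcs1 b)) (Finset.mem_univ a)
    rw [Finset.sum_sub_distrib] at this
    linarith
  by_cases hca0 : c a0 < q a0
  · have hb := (hball' s fun a => by
      rw [abs_lt]; constructor <;> linarith [hsa a, hcs1 a]).2 hca0
    have := hmax s ⟨hs, hsq, hb, by linarith⟩
    linarith
  · have hn' : (0:ℝ) < n := by exact_mod_cast hn
    set δ' := δ / (2 * n) with hδ'
    have hδ'0 : 0 < δ' := by positivity
    have hδ'n : n * δ' = δ / 2 := by rw [hδ']; field_simp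
    have hδ'δ : δ' ≤ δ := by
      have : (1:ℝ) ≤ n := by exact_mod_cast hn
      nlinarith
    obtain ⟨k, hkY, hkd⟩ := Metric.mem_closure_iff.mp hcY δ' hδ'0
    have hka : ∀ a, |k a - c a| < δ' := fun a => by
      have := (dist_pi_lt_iff hδ'0).mp hkd a
      rwa [Real.dist_eq, abs_sub_comm] at this
    have hka1 : ∀ a, k a < c a + δ' := fun a => by have := abs_lt.mp (hka a); linarith
    have hka2 : ∀ a, c a - δ' < k a := fun a => by have := abs_lt.mp (hka a); linarith
    let P : Fin n → ℝ := fun a => max (s a) (k a)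
    have hP : EFp u P := (max_lem ha hs hkY.1).1
    let g : Fin n → ℝ := fun a => if c a < q a then P a else k a
    have hkg : k ≤ g := by
      intro a
      by_cases h : c a < q a
      · simp only [g, h, if_true, P]; exact le_max_right _ _
      · simp [g, h]
    have hPb : ∀ a, |P a - c a| < η := by
      intro a
      have e1 : P a ≤ c a + δ := max_le (hsa a) (by linarith [hka1 a])
      have e2 : s a ≤ P a := le_max_left _ _
      have e3 := hcs1 a
      rw [abs_lt]; constructor <;> linarith
    have hkb : ∀ a, |k a - c a| < η := fun a => (hka a).trans (by linarith)
    have hgb : ∀ a, |g a - c a| < η := by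
      intro a
      by_cases h : c a < q a
      · simp only [g, h, if_true]; exact hPb a
      · simp only [g, h, if_false]; exact hkb a
    have hgEF : EFp u g := by
      refine glue_lem ha hF.1 hP hkY.1 (fun a => c a < q a) ?_ ?_ hkg
        (hball' P hPb).1 (hball' k hkb).1 (hball' g hgb).1
      · intro a h; simp [g, h]
      · intro a h; simp only [g, h, if_false]
    have hgq : g ≤ q := by
      intro a
      by_cases h : c a < q a
      · simp only [g, h, if_true, P]; exact max_le (hsq a) (hkY.2.1 a)
      · simp only [g, h, if_false]; exact hkY.2.1 a
    have hga0 : g a0 < q a0 := by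
      simp only [g, hca0, if_false]; exact hkY.2.2.1
    have hgs : ∀ a, s a - δ' ≤ g a := by
      intro a
      by_cases h : c a < q a
      · simp only [g, h, if_true, P]; linarith [le_max_left (s a) (k a)]
      · simp only [g, h, if_false]
        have := hsq a
        linarith [hka2 a, not_lt.mp h]
    have hsum : ∑ a, s a - n * δ' ≤ ∑ a, g a := by
      have := Finset.sum_le_sum fun a (_ : a ∈ Finset.univ) => hgs a
      rw [Finset.sum_sub_distrib] at this
      simpa using this
    have := hmax g ⟨hgEF, hgq, hga0, by linarith⟩
    linarith

lemma perturb_all (hn : 0 < n) (hc : ∀ i a, Continuous fun p => u i p a)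
    (ha : ∀ i a, StrictAnti fun p => u i p a)
    (hcomp : ∀ i : Fin n, ∀ a c : Fin n, ∀ p : ℝ, ∃ q : ℝ, u i p a = u i q c)
    {q : Fin n → ℝ} (hq : EFp u q) (S : Finset (Fin n)) : ∀ (ε : ℝ), 0 < ε →
    ∃ s, EFp u s ∧ s ≤ q ∧ (∀ a ∈ S, s a < q a) ∧ ∑ a, q a - ε < ∑ a, s a := by
  classical
  induction S using Finset.induction_on with
  | empty => intro ε hε; exact ⟨q, hq, le_rfl, by simp, by linarith⟩
  | insert b S _ ih =>
    intro ε hε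
    obtain ⟨s, h1, h2, h3, h4⟩ := ih (ε / 2) (by linarith)
    obtain ⟨t, k1, k2, k3, k4⟩ := perturb_one hn hc ha hcomp hq b (ε / 2) (by linarith)
    refine ⟨fun a => min (s a) (t a), min_lem ha h1 k1, fun a => (min_le_left _ _).trans (h2 a),
      ?_, ?_⟩
    · intro a haS
      rcases Finset.mem_insert.mp haS with rfl | h
      · exact (min_le_right _ _).trans_lt k3
      · exact (min_le_left _ _).trans_lt (h3 a h)
    · have : ∑ a, (s a + t a - q a) ≤ ∑ a, min (s a) (t a) := by
        apply Finset.sum_le_sum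
        intro a _
        apply le_min
        · linarith [k2 a]
        · linarith [h2 a]
      rw [Finset.sum_sub_distrib, Finset.sum_add_distrib] at this
      linarith

lemma efp_of_envyFree {r : Fin n → ℝ} {σ : Equiv.Perm (Fin n)} (h : EnvyFree n u r σ) :
    EFa u r σ := by
  refine ⟨σ.injective, fun i a => ?_⟩
  have := h i (σ.symm a)
  simpa using this

lemma compact_EF (hn : 0 < n) (hc : ∀ i a, Continuous fun p => u i p a)
    (ha : ∀ i a, StrictAnti fun p => u i p a)
    (hcomp : ∀ i : Fin n, ∀ a c : Fin n, ∀ p : ℝ, ∃ q : ℝ, u i p a = u i q c) (m : ℝ) :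
    IsCompact {p | EFp u p ∧ ∑ a, p a = m} := by
  obtain ⟨B, hB⟩ := exists_bound ha hcomp (m / n)
  have hn' : (0:ℝ) < n := by exact_mod_cast hn
  refine (isCompact_Icc (a := fun _ : Fin n => m - (n * B - B)) (b := fun _ => B)).of_isClosed_subset
    ((closed_EF hc).inter (isClosed_eq cont_sum continuous_const)) ?_
  rintro p ⟨⟨f, hf⟩, hs⟩
  have hle : ∀ c, p c ≤ B := by
    intro c
    obtain ⟨i, rfl⟩ := Finite.injective_iff_surjective.mp hf.1 c
    have : ∃ a, p a ≤ m / n := by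
      by_contra hcon
      push Not at hcon
      have : ∑ _a : Fin n, m / n < ∑ a, p a :=
        Finset.sum_lt_sum_of_nonempty ⟨⟨0, hn⟩, Finset.mem_univ _⟩ fun a _ => hcon a
      rw [hs] at this
      simp at this
      field_simp at this
      exact lt_irrefl _ this
    obtain ⟨a, h⟩ := this
    exact hB i a (f i) _ (((ha i a).antitone h).trans (hf.2 i a))
  refine ⟨fun c => ?_, hle⟩
  have : B - p c ≤ ∑ b, (B - p b) :=
    Finset.single_le_sum (f := fun b => B - p b)
      (fun b _ => sub_nonneg.mpr (hle b)) (Finset.mem_univ c)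
  rw [Finset.sum_sub_distrib, hs] at this
  simp at this
  simp only
  linarith

lemma exists_maxmin (hn : 0 < n) (hc : ∀ i a, Continuous fun p => u i p a)
    (ha : ∀ i a, StrictAnti fun p => u i p a)
    (hcomp : ∀ i : Fin n, ∀ a c : Fin n, ∀ p : ℝ, ∃ q : ℝ, u i p a = u i q c) (m : ℝ) :
    ∃ (r : Fin n → ℝ) (σ : Equiv.Perm (Fin n)), MaxminEF n u m r σ := by
  haveI : Nonempty (Fin n) := ⟨⟨0, hn⟩⟩
  let V : (Fin n → ℝ) → ℝ := fun p => Finset.univ.inf' Finset.univ_nonempty fun i =>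
    Finset.univ.sup' Finset.univ_nonempty fun a => u i (p a) a
  have hV : Continuous V :=
    Continuous.finset_inf'_apply _ fun i _ => Continuous.finset_sup'_apply _ fun a _ =>
      (hc i a).comp (continuous_apply a)
  have hVe : ∀ p (σ : Fin n → Fin n), EFa u p σ → (⨅ i, u i (p (σ i)) (σ i)) = V p := by
    intro p σ h
    simp only [V]
    rw [Finset.inf'_univ_eq_ciInf]
    congr 1
    ext i
    apply le_antisymm
    · exact Finset.le_sup' (f := fun a => u i (p a) a) (Finset.mem_univ (σ i))
    · exact Finset.sup'_le _ _ fun a _ => h.2 i a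
  obtain ⟨t0, ht0, hm0⟩ := exists_EF hn hc ha hcomp m
  obtain ⟨r, ⟨⟨f, hf⟩, hrm⟩, hmax⟩ := (compact_EF hn hc ha hcomp m).exists_isMaxOn
    ⟨t0, ht0, hm0⟩ hV.continuousOn
  let σ : Equiv.Perm (Fin n) := Equiv.ofBijective f (Finite.injective_iff_bijective.mp hf.1)
  refine ⟨r, σ, hrm, fun i j => hf.2 i _, fun t γ htm hγ => ?_⟩
  have h1 := hVe t γ (efp_of_envyFree hγ)
  have h2 : (⨅ i, u i (r (σ i)) (σ i)) = V r := hVe r f hf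
  rw [h1, h2]
  have := hmax (show t ∈ {p | EFp u p ∧ ∑ a, p a = m} from ⟨⟨γ, efp_of_envyFree hγ⟩, htm⟩)
  simpa using this

lemma unique_maxmin (hn : 0 < n) (hc : ∀ i a, Continuous fun p => u i p a)
    (ha : ∀ i a, StrictAnti fun p => u i p a)
    (hcomp : ∀ i : Fin n, ∀ a c : Fin n, ∀ p : ℝ, ∃ q : ℝ, u i p a = u i q c) (m : ℝ)
    (r t : Fin n → ℝ) (σ γ : Equiv.Perm (Fin n))
    (hr : MaxminEF n u m r σ) (ht : MaxminEF n u m t γ) : r = t := by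
  haveI : Nonempty (Fin n) := ⟨⟨0, hn⟩⟩
  by_contra hne
  have hrE := efp_of_envyFree hr.2.1
  have htE := efp_of_envyFree ht.2.1
  set w := ⨅ i, u i (r (σ i)) (σ i) with hw
  have hw' : (⨅ i, u i (t (γ i)) (γ i)) = w :=
    le_antisymm (hr.2.2 t γ ht.1 ht.2.1) (ht.2.2 r σ hr.1 hr.2.1)
  have w1 : ∀ i, ∃ a, w ≤ u i (r a) a := fun i =>
    ⟨σ i, ciInf_le (Set.finite_range fun i => u i (r (σ i)) (σ i)).bddBelow i⟩
  have w2 : ∀ i, ∃ a, w ≤ u i (t a) a := fun i =>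
    ⟨γ i, hw' ▸ ciInf_le (Set.finite_range fun i => u i (t (γ i)) (γ i)).bddBelow i⟩
  obtain ⟨hq, hqw⟩ := max_lem ha ⟨σ, hrE⟩ ⟨γ, htE⟩
  replace hqw := hqw w w1 w2
  set q := fun a => max (r a) (t a) with hqd
  have hlt : m < ∑ a, q a := by
    by_contra hcon
    push Not at hcon
    apply hne
    have e1 : ∀ a, r a = q a := by
      have := (Finset.sum_eq_sum_iff_of_le (s := Finset.univ) (f := r) (g := q)
        fun a _ => le_max_left _ _).mp (le_antisymm
          (Finset.sum_le_sum fun a _ => le_max_left _ _) (by rw [hr.1]; exact hcon))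
      exact fun a => this a (Finset.mem_univ _)
    have e2 : ∀ a, t a = q a := by
      have := (Finset.sum_eq_sum_iff_of_le (s := Finset.univ) (f := t) (g := q)
        fun a _ => le_max_right _ _).mp (le_antisymm
          (Finset.sum_le_sum fun a _ => le_max_right _ _) (by rw [ht.1]; exact hcon))
      exact fun a => this a (Finset.mem_univ _)
    ext a; rw [e1, e2]
  obtain ⟨s, hs, -, hsq, hss⟩ := perturb_all hn hc ha hcomp hq Finset.univ (∑ a, q a - m)
    (by linarith)
  obtain ⟨T, ⟨f, hf⟩, hTs, hTm⟩ := below_lem hn hc ha hcomp hs m (by linarith)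
  let τ : Equiv.Perm (Fin n) := Equiv.ofBijective f (Finite.injective_iff_bijective.mp hf.1)
  have hle : (⨅ i, u i (T (f i)) (f i)) ≤ w := hr.2.2 T τ hTm (fun i j => hf.2 i _)
  obtain ⟨i, hi⟩ := exists_eq_ciInf_of_finite (f := fun i => u i (T (f i)) (f i))
  obtain ⟨a, haw⟩ := hqw i
  have e1 := hf.2 i a
  have e2 := ha i a (lt_of_le_of_lt (hTs a) (hsq a (Finset.mem_univ _)))
  simp only at e2 hi
  rw [← hi] at hle
  have e3 : w ≤ u i (q a) a := haw
  linarith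

end

/-- (i) for every profile of continuous money-monotone
preferences satisfying the compensation assumption, a maxmin-utility envy-free
allocation exists; and (ii) in the budget-constrained quasi-linear domain the
maxmin-utility envy-free price vector for a given total rent is unique, and all
agents are indifferent between any two such allocations. -/
theorem stmt_18 (n : ℕ) (hn : 0 < n) (m : ℝ) :
    (∀ u : Fin n → ℝ → Fin n → ℝ,
      (∀ i a, Continuous fun p => u i p a) →
      (∀ i a, StrictAnti fun p => u i p a) →
      (∀ i : Fin n, ∀ a c : Fin n, ∀ p : ℝ, ∃ q : ℝ, u i p a = u i q c) →
      ∃ (r : Fin n → ℝ) (σ : Equiv.Perm (Fin n)), MaxminEF n u m r σ) ∧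
    (∀ (v : Fin n → Fin n → ℝ) (b ρ : Fin n → ℝ),
      (∀ i, 0 ≤ b i) → (∀ i, 0 ≤ ρ i) →
      ∀ u : Fin n → ℝ → Fin n → ℝ,
      (∀ i p a, u i p a = v i a - p - ρ i * max 0 (p - b i)) →
      ∀ (r t : Fin n → ℝ) (σ γ : Equiv.Perm (Fin n)),
        MaxminEF n u m r σ → MaxminEF n u m t γ →
        r = t ∧ ∀ i, u i (r (σ i)) (σ i) = u i (t (γ i)) (γ i)) := by
  refine ⟨fun u hc ha hcomp => exists_maxmin hn hc ha hcomp m, ?_⟩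
  intro v b ρ hb hρ u hu r t σ γ hr ht
  have hc : ∀ i a, Continuous fun p => u i p a := by
    intro i a
    simp only [hu]
    fun_prop
  have ha : ∀ i a, StrictAnti fun p => u i p a := by
    intro i a p q hpq
    simp only [hu]
    have : max 0 (p - b i) ≤ max 0 (q - b i) := max_le_max le_rfl (by linarith)
    have := mul_le_mul_of_nonneg_left this (hρ i)
    linarith
  have hcomp : ∀ i : Fin n, ∀ a c : Fin n, ∀ p : ℝ, ∃ q : ℝ, u i p a = u i q c := by
    intro i a c p
    have e : ∀ x, u i x c ≤ v i c - x := by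
      intro x
      rw [hu]
      have : 0 ≤ ρ i * max 0 (x - b i) := mul_nonneg (hρ i) (le_max_left _ _)
      linarith
    have h1 : u i (v i c - u i p a) c ≤ u i p a := (e _).trans (by linarith)
    have h2 : u i p a ≤ u i (min 0 (v i c - u i p a)) c := by
      have h0 : max 0 (min 0 (v i c - u i p a) - b i) = 0 :=
        max_eq_left (by linarith [hb i, min_le_left 0 (v i c - u i p a)])
      rw [hu i (min 0 (v i c - u i p a)) c, h0]
      linarith [min_le_right 0 (v i c - u i p a)]
    obtain ⟨q, hq⟩ := mem_range_of_exists_le_of_exists_ge (hc i c) ⟨_, h1⟩ ⟨_, h2⟩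
    exact ⟨q, hq.symm⟩
  have hrt : r = t := unique_maxmin hn hc ha hcomp m r t σ γ hr ht
  refine ⟨hrt, fun i => ?_⟩
  subst hrt
  exact le_antisymm ((efp_of_envyFree ht.2.1).2 i _) ((efp_of_envyFree hr.2.1).2 i _)
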